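/- Let n ≥ 3 and let R ∈ S²_B(so(n)) be a curvature operator of Ricci type, i.e. R = (λ̄/(n−1))·I + (2/(n−2))·(Ric₀∧id). Then the Ricci tensor of R² + R^# equals −(2/(n−2))·(Ric₀²)₀ + ((n−2)/(n−1))·λ̄·Ric₀ + λ̄²·id + σ·id, where (Ric₀²)₀ := Ric₀² − (tr(Ric₀²)/n)·id. -/

import Mathlib

/-!
Common setup: we identify ⋀²ℝⁿ with the Lie algebra `so n` of real skew-symmetric
`n × n` matrices, sending `eᵢ ∧ eⱼ` to the rotation by `π/2` in the plane spanned by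
`eᵢ, eⱼ`; the inner product on `so n` is `⟪A, B⟫ = -(1/2)·tr (A * B)`, and under this
identification `v ∧ w` corresponds to the skew-symmetric matrix `v wᵀ - w vᵀ`, while
the wedge `A ∧ B` of two endomorphisms of `ℝⁿ` acts on a skew matrix `M` by
`M ↦ (1/2)(A M Bᵀ + B M Aᵀ)` (the unique linear extension of
`v∧w ↦ (1/2)(Av ∧ Bw + Bv ∧ Aw)`).
-/

noncomputable section

namespace BW

open Matrix

abbrev Mat (n : ℕ) := Matrix (Fin n) (Fin n) ℝ

/-- `so n`: the space of real skew-symmetric `n × n` matrices (≅ ⋀²ℝⁿ). -/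
def so (n : ℕ) : Submodule ℝ (Mat n) where
  carrier := {A | Aᵀ = -A}
  add_mem' := by
    intro A B hA hB
    simp only [Set.mem_setOf_eq] at *
    rw [Matrix.transpose_add, hA, hB, neg_add]
  zero_mem' := by simp
  smul_mem' := by
    intro c A hA
    simp only [Set.mem_setOf_eq] at *
    rw [Matrix.transpose_smul, hA, smul_neg]

variable {n : ℕ}

lemma mem_so_iff {A : Mat n} : A ∈ so n ↔ Aᵀ = -A := Iff.rfl

/-- The inner product `⟨A,B⟩ = -(1/2)·tr(AB)` on `so n`. -/
def ip (A B : so n) : ℝ := -(1/2) * Matrix.trace ((A : Mat n) * (B : Mat n))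

/-- `ip` as a linear map in the second variable. -/
def ipL (A : so n) : so n →ₗ[ℝ] ℝ where
  toFun B := ip A B
  map_add' B C := by
    simp only [ip, Submodule.coe_add, Matrix.mul_add, Matrix.trace_add]; ring
  map_smul' c B := by
    simp only [ip, SetLike.val_smul, Matrix.mul_smul, Matrix.trace_smul, smul_eq_mul,
      RingHom.id_apply]; ring

/-- The Lie bracket (matrix commutator) on `so n`. -/
def brk (A B : so n) : so n :=
  ⟨(A : Mat n) * (B : Mat n) - (B : Mat n) * (A : Mat n), by
    have hA : (A : Mat n)ᵀ = -(A : Mat n) := A.2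
    have hB : (B : Mat n)ᵀ = -(B : Mat n) := B.2
    rw [mem_so_iff, Matrix.transpose_sub, Matrix.transpose_mul, Matrix.transpose_mul, hA, hB]
    noncomm_ring⟩

/-- Auxiliary linear map underlying `A ∧ B`. -/
def wedgeAux (A B : Mat n) : Mat n →ₗ[ℝ] Mat n where
  toFun M := (1/2 : ℝ) • (A * M * Bᵀ + B * M * Aᵀ)
  map_add' M N := by
    simp only [mul_add, add_mul, smul_add]
    module
  map_smul' c M := by
    simp only [mul_smul_comm, smul_mul_assoc, RingHom.id_apply]
    module

lemma wedgeAux_mem (A B : Mat n) : ∀ M ∈ so n, wedgeAux A B M ∈ so n := by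
  intro M hM
  rw [mem_so_iff] at hM ⊢
  show ((1/2 : ℝ) • (A * M * Bᵀ + B * M * Aᵀ))ᵀ = -((1/2 : ℝ) • (A * M * Bᵀ + B * M * Aᵀ))
  rw [Matrix.transpose_smul, Matrix.transpose_add, Matrix.transpose_mul, Matrix.transpose_mul,
    Matrix.transpose_mul, Matrix.transpose_mul, Matrix.transpose_transpose,
    Matrix.transpose_transpose, hM]
  simp only [Matrix.neg_mul, Matrix.mul_neg, Matrix.mul_assoc, smul_neg, neg_add, smul_add]
  abel

/-- The wedge `A ∧ B` of two endomorphisms of ℝⁿ, as an endomorphism of `so n ≅ ⋀²ℝⁿ`: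
the unique linear map with `(A ∧ B)(v ∧ w) = (1/2)(Av ∧ Bw + Bv ∧ Aw)`. -/
def wedge (A B : Mat n) : Module.End ℝ (so n) :=
  (wedgeAux A B).restrict (p := so n) (q := so n) (wedgeAux_mem A B)

/-- The index set of pairs `i < j`. -/
def pairs (n : ℕ) : Finset (Fin n × Fin n) := Finset.univ.filter fun p => p.1 < p.2

/-- The standard basis vector `eᵢ` of ℝⁿ. -/
def evec (i : Fin n) : Fin n → ℝ := fun k => if k = i then 1 else 0

/-- `v ∧ w`, as an element of `so n ≅ ⋀²ℝⁿ`. -/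
def vwedge (v w : Fin n → ℝ) : so n :=
  ⟨Matrix.of fun i j => v i * w j - w i * v j, by
    rw [mem_so_iff]
    ext i j
    simp only [Matrix.transpose_apply, Matrix.of_apply, Matrix.neg_apply]
    ring⟩

/-- The orthonormal basis vector `eᵢ ∧ eⱼ` of `so n ≅ ⋀²ℝⁿ`. -/
def bvec (i j : Fin n) : so n := vwedge (evec i) (evec j)

/-- Hamilton's sharp product `R # S`: the self-adjoint endomorphism of `so n` determined by
`⟨(R#S)h, h⟩ = (1/2)·Σ_{α,β} ⟨[R(b_α), S(b_β)], h⟩·⟨[b_α, b_β], h⟩`,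
where `(b_α)` is the orthonormal basis `(eᵢ ∧ eⱼ)_{i<j}` of `so n`. -/
def sharp (R S : Module.End ℝ (so n)) : Module.End ℝ (so n) :=
  (1/4 : ℝ) • ∑ p ∈ pairs n, ∑ q ∈ pairs n,
    ((ipL (brk (R (bvec p.1 p.2)) (S (bvec q.1 q.2)))).smulRight
        (brk (bvec p.1 p.2) (bvec q.1 q.2))
      + (ipL (brk (bvec p.1 p.2) (bvec q.1 q.2))).smulRight
        (brk (R (bvec p.1 p.2)) (S (bvec q.1 q.2))))

/-- The right-hand side `R² + R^#` of Hamilton's ODE. -/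
def Qode (R : Module.End ℝ (so n)) : Module.End ℝ (so n) := R * R + sharp R R

/-- The coordinates `R_{ijkl} = ⟨R(eᵢ∧eⱼ), e_k∧e_l⟩` of an endomorphism of `so n`. -/
def Rcoord (R : Module.End ℝ (so n)) (i j k l : Fin n) : ℝ := ip (R (bvec i j)) (bvec k l)

/-- Self-adjointness with respect to the inner product `ip`. -/
def selfAdjEnd (R : Module.End ℝ (so n)) : Prop := ∀ X Y : so n, ip (R X) Y = ip X (R Y)

/-- A curvature operator: a self-adjoint endomorphism of `so n ≅ ⋀²ℝⁿ` satisfying the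
first Bianchi identity.  (`isCurvOp` carves out `S²_B(so n)`.) -/
def isCurvOp (R : Module.End ℝ (so n)) : Prop :=
  selfAdjEnd R ∧
    ∀ i j k l : Fin n, Rcoord R i j k l + Rcoord R j k i l + Rcoord R k i j l = 0

/-- The Ricci tensor `Ric_{ij} = Σ_k R_{ikjk}` of `R`. -/
def RicM (R : Module.End ℝ (so n)) : Mat n := Matrix.of fun i j => ∑ k, Rcoord R i k j k

/-- `λ̄ = tr(Ric)/n`. -/
def lamb (R : Module.End ℝ (so n)) : ℝ := Matrix.trace (RicM R) / (n : ℝ)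

/-- The traceless Ricci tensor `Ric₀ = Ric - (tr Ric / n)·id`. -/
def Ric0 (R : Module.End ℝ (so n)) : Mat n := RicM R - lamb R • (1 : Mat n)

/-- `σ = tr(Ric₀²)/n`. -/
def sigmaR (R : Module.End ℝ (so n)) : ℝ := Matrix.trace (Ric0 R * Ric0 R) / (n : ℝ)

/-- `R_I = (λ̄/(n-1))·(id ∧ id)`, the projection of `R` onto `⟨I⟩`. -/
def RI (R : Module.End ℝ (so n)) : Module.End ℝ (so n) :=
  (lamb R / ((n : ℝ) - 1)) • wedge (1 : Mat n) (1 : Mat n)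

/-- `R_{Ric₀} = (2/(n-2))·(Ric₀ ∧ id)`, the projection of `R` onto `⟨Ric₀⟩`. -/
def RRic0 (R : Module.End ℝ (so n)) : Module.End ℝ (so n) :=
  (2 / ((n : ℝ) - 2)) • wedge (Ric0 R) (1 : Mat n)

/-- The linear map `ℓ_{a,b}(R) = R + 2(n-1)a·R_I + (n-2)b·R_{Ric₀}`. -/
def lab (a b : ℝ) (R : Module.End ℝ (so n)) : Module.End ℝ (so n) :=
  R + (2 * ((n : ℝ) - 1) * a) • RI R + (((n : ℝ) - 2) * b) • RRic0 R

/-- Positive semidefiniteness of the quadratic form of an endomorphism of `so n`. -/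
def posSemidefEnd (R : Module.End ℝ (so n)) : Prop := ∀ X : so n, 0 ≤ ip (R X) X

/-- Positive definiteness of the quadratic form of an endomorphism of `so n`. -/
def posDefEnd (R : Module.End ℝ (so n)) : Prop := ∀ X : so n, X ≠ 0 → 0 < ip (R X) X

/-- `R` is 2-nonnegative: the sum of its two smallest eigenvalues is nonnegative;
equivalently (Ky Fan), `q_R(X) + q_R(Y) ≥ 0` for all orthonormal pairs `X, Y`. -/
def twoNonneg (R : Module.End ℝ (so n)) : Prop :=
  ∀ X Y : so n, ip X X = 1 → ip Y Y = 1 → ip X Y = 0 → 0 ≤ ip (R X) X + ip (R Y) Y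

/-- The (Frobenius) norm of an endomorphism of `so n`, computed in the orthonormal
basis `(eᵢ ∧ eⱼ)_{i<j}`. -/
def endNorm (R : Module.End ℝ (so n)) : ℝ :=
  Real.sqrt (∑ p ∈ pairs n, ip (R (bvec p.1 p.2)) (R (bvec p.1 p.2)))

/-- The tangent cone `T_R C`: the closure of `{t·(S - R) : S ∈ C, t ≥ 0}`. -/
def tangCone (C : Set (Module.End ℝ (so n))) (R : Module.End ℝ (so n)) :
    Set (Module.End ℝ (so n)) :=
  {X | ∀ ε > 0, ∃ S ∈ C, ∃ t : ℝ, 0 ≤ t ∧ endNorm (X - t • (S - R)) < ε}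

/-- `C` is a closed subset of the space of endomorphisms of `so n`. -/
def isClosedSet (C : Set (Module.End ℝ (so n))) : Prop :=
  ∀ X, (∀ ε > 0, ∃ Y ∈ C, endNorm (X - Y) < ε) → X ∈ C

/-- The interior of `C` relative to the subspace `S²_B(so n)` of curvature operators. -/
def interiorCurv (C : Set (Module.End ℝ (so n))) : Set (Module.End ℝ (so n)) :=
  {X | isCurvOp X ∧ ∃ ε > 0, ∀ Y, isCurvOp Y → endNorm (Y - X) < ε → Y ∈ C}

/-- Auxiliary linear map `M ↦ g M gᵀ` on matrices. -/
def conjAux (g : Mat n) : Mat n →ₗ[ℝ] Mat n where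
  toFun M := g * M * gᵀ
  map_add' M N := by simp only [mul_add, add_mul]
  map_smul' c M := by simp only [mul_smul_comm, smul_mul_assoc, RingHom.id_apply]

/-- `⋀²g` : the action `M ↦ g M gᵀ` of `g` on `so n ≅ ⋀²ℝⁿ` (for `g` orthogonal this is
the second exterior power of `g`). -/
def conjSo (g : Mat n) : Module.End ℝ (so n) :=
  (conjAux g).restrict (p := so n) (q := so n) (fun M hM => by
    rw [mem_so_iff] at hM ⊢
    show (g * M * gᵀ)ᵀ = -(g * M * gᵀ)
    rw [Matrix.transpose_mul, Matrix.transpose_mul, Matrix.transpose_transpose, hM]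
    simp only [Matrix.neg_mul, Matrix.mul_neg, Matrix.mul_assoc])

/-- The action `g · R = (⋀²g) ∘ R ∘ (⋀²g)⁻¹` of an orthogonal matrix `g`
(whose inverse is `gᵀ`) on endomorphisms of `so n`. -/
def onAct (g : Mat n) (R : Module.End ℝ (so n)) : Module.End ℝ (so n) :=
  conjSo g * R * conjSo gᵀ

/-- Two sets are at Hausdorff distance at most `ε` from each other. -/
def hdClose (A B : Set (Module.End ℝ (so n))) (ε : ℝ) : Prop :=
  (∀ X ∈ A, ∃ Y ∈ B, endNorm (X - Y) ≤ ε) ∧ ∀ Y ∈ B, ∃ X ∈ A, endNorm (X - Y) ≤ ε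

/-- The truncation `C ∩ {‖R‖ ≤ 1}`. -/
def truncSet (C : Set (Module.End ℝ (so n))) : Set (Module.End ℝ (so n)) :=
  {R ∈ C | endNorm R ≤ 1}


lemma coe_bvec (i j : Fin n) :
    (bvec i j : Mat n) = Matrix.single i j 1 - Matrix.single j i 1 := by
  ext a b
  simp only [bvec, vwedge, evec, Matrix.of_apply, Matrix.sub_apply, Matrix.single_apply, ite_and,
    mul_ite, mul_one, mul_zero, @eq_comm _ i, @eq_comm _ j]
  split_ifs <;> rfl

lemma apply_swap (X : so n) (i j : Fin n) : (X : Mat n) i j = -(X : Mat n) j i := by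
  have h := congrFun (congrFun (mem_so_iff.1 X.2) j) i
  simpa using h

lemma bvec_swap (i j : Fin n) : bvec i j = -bvec j i := by
  ext1
  simp [coe_bvec]

lemma bvec_self (i : Fin n) : bvec i i = 0 := by
  ext1
  simp [coe_bvec]

lemma ip_comm (X Y : so n) : ip X Y = ip Y X := by
  rw [ip, ip, Matrix.trace_mul_comm]

lemma ip_bvec (X : so n) (i j : Fin n) : ip X (bvec i j) = (X : Mat n) i j := by
  have h := apply_swap X j i
  simp only [ip, coe_bvec, mul_sub, Matrix.trace_sub, Matrix.trace_mul_single]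
  simp only [MulOpposite.op_one, one_smul, h]
  ring

lemma Rcoord_eq (R : Module.End ℝ (so n)) (i j k l : Fin n) :
    Rcoord R i j k l = (R (bvec i j) : Mat n) k l := ip_bvec _ _ _

lemma ip_brk_left (X Y Z : so n) : ip (brk X Y) Z = ip Y (brk Z X) := by
  simp only [ip, brk, sub_mul, mul_sub, Matrix.trace_sub, ← Matrix.mul_assoc]
  rw [Matrix.trace_mul_cycle (Y : Mat n) (Z : Mat n) (X : Mat n)]

/-- A symmetric sum over pairs `i < j` is half the sum over all `i, j`. -/
lemma sum_pairs {V : Type*} [AddCommGroup V] [Module ℝ V] (f : Fin n → Fin n → V)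
    (hswap : ∀ i j, f i j = f j i) (hdiag : ∀ i, f i i = 0) :
    ∑ p ∈ pairs n, f p.1 p.2 = (1 / 2 : ℝ) • ∑ i, ∑ j, f i j := by
  have hlt : ∑ p ∈ pairs n, f p.1 p.2 = ∑ i, ∑ j, if i < j then f i j else 0 := by
    rw [pairs, Finset.sum_filter, Fintype.sum_prod_type]
  have hgt : ∑ p ∈ pairs n, f p.1 p.2 = ∑ i, ∑ j, if j < i then f i j else 0 := by
    rw [hlt, Finset.sum_comm]
    refine Finset.sum_congr rfl fun i _ => Finset.sum_congr rfl fun j _ => ?_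
    rw [hswap]
  have hsum : ∑ i, ∑ j, f i j = (2 : ℝ) • ∑ p ∈ pairs n, f p.1 p.2 := by
    rw [two_smul]
    nth_rewrite 1 [hlt]
    rw [hgt, ← Finset.sum_add_distrib]
    refine Finset.sum_congr rfl fun i _ => ?_
    rw [← Finset.sum_add_distrib]
    refine Finset.sum_congr rfl fun j _ => ?_
    rcases lt_trichotomy i j with h | h | h
    · simp [h, h.not_gt]
    · simp [h, hdiag]
    · simp [h, h.not_gt]
  rw [hsum, smul_smul]
  norm_num

/-- Expansion of `Y` in the orthonormal basis `(eᵢ ∧ eⱼ)_{i<j}`. -/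
lemma sum_pairs_ip_smul_bvec (Y : so n) :
    ∑ q ∈ pairs n, ip (bvec q.1 q.2) Y • bvec q.1 q.2 = Y := by
  rw [sum_pairs (fun i j => ip (bvec i j) Y • bvec i j)]
  · ext a b
    have h := apply_swap Y b a
    simp [ip_comm _ Y, ip_bvec, coe_bvec, Matrix.sum_apply, Matrix.single_apply, mul_sub,
      Finset.sum_sub_distrib, ite_and, h]
    ring
  · intro i j
    simp only [ip_comm _ Y, ip_bvec]
    rw [bvec_swap i j, apply_swap Y i j, neg_smul_neg]
  · intro i
    simp [bvec_self]

/-- `X ↦ [X, ·]` as a linear map. -/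
def brkL (X : so n) : so n →ₗ[ℝ] so n where
  toFun Y := brk X Y
  map_add' Y Z := by
    ext1
    simp only [brk, Submodule.coe_add]
    noncomm_ring
  map_smul' c Y := by
    ext1
    simp [brk, smul_sub]

lemma brkL_apply (X Y : so n) : brkL X Y = brk X Y := rfl

/-- Contraction of one of the two basis sums in the sharp product. -/
lemma sharp_self_apply {R : Module.End ℝ (so n)} (hR : selfAdjEnd R) (X : so n) :
    sharp R R X = (1 / 4 : ℝ) • ∑ p ∈ pairs n,
      (brk (bvec p.1 p.2) (R (brk X (R (bvec p.1 p.2))))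
        + brk (R (bvec p.1 p.2)) (R (brk X (bvec p.1 p.2)))) := by
  simp only [sharp, LinearMap.smul_apply, LinearMap.sum_apply, LinearMap.add_apply,
    LinearMap.smulRight_apply, Finset.sum_add_distrib]
  congr 2
  · refine Finset.sum_congr rfl fun p _ => ?_
    conv_rhs => rw [← sum_pairs_ip_smul_bvec (R (brk X (R (bvec p.1 p.2)))), ← brkL_apply, map_sum]
    refine Finset.sum_congr rfl fun q _ => ?_
    rw [map_smul, brkL_apply, ← hR, ← ip_brk_left]
    rfl
  · refine Finset.sum_congr rfl fun p _ => ?_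
    conv_rhs => rw [← sum_pairs_ip_smul_bvec (brk X (bvec p.1 p.2)), map_sum, ← brkL_apply, map_sum]
    refine Finset.sum_congr rfl fun q _ => ?_
    rw [map_smul, map_smul, brkL_apply, ← ip_brk_left]
    rfl

lemma sum_bvec_mul_mul_bvec (C : Mat n) :
    ∑ a, ∑ b, ((bvec a b : so n) : Mat n) * C * ((bvec a b : so n) : Mat n)
      = (2 : ℝ) • (Cᵀ - C.trace • (1 : Mat n)) := by
  ext i j
  by_cases h : i = j
  · subst h
    simp [coe_bvec, sub_mul, mul_sub, Finset.sum_sub_distrib, Matrix.sum_apply,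
      Matrix.single_apply, ite_and, Matrix.trace]
    ring
  · simp [coe_bvec, sub_mul, mul_sub, Finset.sum_sub_distrib, Matrix.sum_apply,
      Matrix.single_apply, ite_and, h]
    ring

lemma sum_mul_bvec_mul_bvec_mul (A C D : Mat n) :
    ∑ a, ∑ b, A * ((bvec a b : so n) : Mat n) * C * ((bvec a b : so n) : Mat n) * D
      = (2 : ℝ) • (A * Cᵀ * D - C.trace • (A * D)) := by
  have h : ∑ a, ∑ b, A * ((bvec a b : so n) : Mat n) * C * ((bvec a b : so n) : Mat n) * D
      = A * (∑ a, ∑ b, ((bvec a b : so n) : Mat n) * C * ((bvec a b : so n) : Mat n)) * D := by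
    simp only [Matrix.mul_sum, Matrix.sum_mul, Matrix.mul_assoc]
  rw [h, sum_bvec_mul_mul_bvec]
  simp [mul_sub, sub_mul]

lemma trace_symm_mul_skew {S M : Mat n} (hS : Sᵀ = S) (hM : Mᵀ = -M) :
    (S * M).trace = 0 := by
  have h := Matrix.trace_transpose (S * M)
  rw [Matrix.transpose_mul, hS, hM, Matrix.neg_mul, Matrix.trace_neg, Matrix.trace_mul_comm] at h
  linarith

lemma trace_skew {M : Mat n} (hM : Mᵀ = -M) : M.trace = 0 := by
  simpa using trace_symm_mul_skew (S := 1) (by simp) hM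


lemma commutator_expansion {S : Type*} [Ring S] (B X p : S) :
    (p * (B * (X * (B * p + p * B) - (B * p + p * B) * X)
          + (X * (B * p + p * B) - (B * p + p * B) * X) * B)
        - (B * (X * (B * p + p * B) - (B * p + p * B) * X)
          + (X * (B * p + p * B) - (B * p + p * B) * X) * B) * p)
      + ((B * p + p * B) * (B * (X * p - p * X) + (X * p - p * X) * B)
        - (B * (X * p - p * X) + (X * p - p * X) * B) * (B * p + p * B))
    = 1 * p * (B * B * X + X * (B * B) + 2 • (B * X * B)) * p * 1 + B * p * (2 • (B * X + X * B)) * p * 1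
      + 1 * p * (2 • (B * X + X * B)) * p * B + B * p * (2 • X) * p * B
      + 1 * p * X * p * (B * B) + (B * B) * p * X * p * 1
      - 1 * p * (2 • (B * B)) * p * X - X * p * (2 • (B * B)) * p * 1
      - B * p * B * p * X - X * p * B * p * B
      - 1 * p * (2 • B) * p * (X * B) - (B * X) * p * (2 • B) * p * 1
      - 1 * p * B * p * (B * X) - (X * B) * p * B * p * 1
      - B * p * 1 * p * (X * B) - (B * X) * p * 1 * p * B
      - 1 * p * 1 * p * (B * X * B) - (B * X * B) * p * 1 * p * 1 := by
  noncomm_ring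

/-- The closed form of `R² + R^#` when `R M = B M + M B`. -/
lemma coe_Qode_apply {R : Module.End ℝ (so n)} (hR : selfAdjEnd R) {B : Mat n} (hB : Bᵀ = B)
    (hRB : ∀ M : so n, (R M : Mat n) = B * M + M * B) (X : so n) :
    (Qode R X : Mat n) = ((n : ℝ) - 2) • (B * X * B) - (B * B * X + X * (B * B))
      + B.trace • (B * X + X * B) + (B * B).trace • (X : Mat n) := by
  have hX : (X : Mat n)ᵀ = -(X : Mat n) := X.2
  have hsharp : (sharp R R X : Mat n) = ((n : ℝ) - 4) • (B * X * B)
      - (2 : ℝ) • (B * B * X + X * (B * B)) + B.trace • (B * X + X * B)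
      + (B * B).trace • (X : Mat n) := by
    rw [sharp_self_apply hR, sum_pairs (fun i j => brk (bvec i j) (R (brk X (R (bvec i j))))
        + brk (R (bvec i j)) (R (brk X (bvec i j))))]
    · simp only [SetLike.val_smul, Submodule.coe_sum, Submodule.coe_add, brk, hRB,
        commutator_expansion]
      simp only [Finset.sum_add_distrib, Finset.sum_sub_distrib,
        sum_mul_bvec_mul_bvec_mul]
      have hBB : (B * B)ᵀ = B * B := by rw [Matrix.transpose_mul, hB]
      have hBX : (B * (X : Mat n)).trace = 0 := trace_symm_mul_skew hB hX
      have hBBX : (B * B * (X : Mat n)).trace = 0 := trace_symm_mul_skew hBB hX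
      have hXB : ((X : Mat n) * B).trace = 0 := by rw [Matrix.trace_mul_comm, hBX]
      have hXBB : ((X : Mat n) * (B * B)).trace = 0 := by rw [Matrix.trace_mul_comm, hBBX]
      have hBXB : (B * (X : Mat n) * B).trace = 0 := by
        rw [Matrix.trace_mul_cycle, hBBX]
      simp only [Matrix.transpose_add, Matrix.transpose_smul, Matrix.transpose_mul,
        Matrix.transpose_one, hB, hX, Matrix.trace_add, Matrix.trace_smul, Matrix.trace_one,
        hBX, hBBX, hXB, hXBB, hBXB, trace_skew hX, Fintype.card_fin, smul_zero, add_zero,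
        zero_smul, sub_zero]
      simp only [one_mul, mul_one, mul_add, add_mul, mul_neg, neg_mul, mul_smul_comm,
        smul_mul_assoc, ← mul_assoc]
      module
    · intro i j
      rw [bvec_swap i j]
      ext1
      simp only [brk, hRB, Submodule.coe_add, Submodule.coe_neg]
      noncomm_ring
    · intro i
      ext1
      simp [brk, bvec_self]
  have hsq : (R (R X) : Mat n) = B * B * X + (2 : ℝ) • (B * X * B) + X * (B * B) := by
    rw [hRB, hRB, two_smul]
    noncomm_ring
  rw [Qode, LinearMap.add_apply, Submodule.coe_add, Module.End.mul_apply, hsharp, hsq]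
  module

lemma sum_mul_bvec_mul (P Q : Mat n) (i j : Fin n) :
    ∑ k, (P * (bvec i k : Mat n) * Q) j k = Q.trace * P j i - (P * Qᵀ) j i := by
  simp [coe_bvec, mul_sub, Finset.sum_sub_distrib, Matrix.trace, Matrix.mul_apply,
    Matrix.single_apply, ite_and, ← Finset.mul_sum, mul_comm]

/-- The Ricci tensor of `R² + R^#` when `R M = B M + M B`. -/
lemma RicM_Qode {R : Module.End ℝ (so n)} (hR : selfAdjEnd R) {B : Mat n} (hB : Bᵀ = B)
    (hRB : ∀ M : so n, (R M : Mat n) = B * M + M * B) :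
    RicM (Qode R) = (-2 * ((n : ℝ) - 2)) • (B * B) + (2 * ((n : ℝ) - 2) * B.trace) • B
      + (B.trace ^ 2 + ((n : ℝ) - 2) * (B * B).trace) • (1 : Mat n) := by
  ext i j
  simp only [RicM, Matrix.of_apply, Rcoord_eq, coe_Qode_apply hR hB hRB]
  have h₁ := sum_mul_bvec_mul B B i j
  have h₂ := sum_mul_bvec_mul (B * B) 1 i j
  have h₃ := sum_mul_bvec_mul 1 (B * B) i j
  have h₄ := sum_mul_bvec_mul B 1 i j
  have h₅ := sum_mul_bvec_mul 1 B i j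
  have h₆ := sum_mul_bvec_mul (1 : Mat n) 1 i j
  simp only [Matrix.transpose_one, Matrix.transpose_mul, hB, Matrix.trace_one, Fintype.card_fin,
    one_mul, mul_one] at h₁ h₂ h₃ h₄ h₅ h₆
  have hBB : (B * B)ᵀ = B * B := by rw [Matrix.transpose_mul, hB]
  have h : (1 : Mat n) j i = (1 : Mat n) i j :=
    congrFun (congrFun (Matrix.transpose_one (n := Fin n) (α := ℝ)) i) j
  have h' : B j i = B i j := congrFun (congrFun hB i) j
  have h'' : (B * B) j i = (B * B) i j := congrFun (congrFun hBB i) j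
  simp only [Matrix.add_apply, Matrix.sub_apply, Matrix.smul_apply, smul_eq_mul,
    Finset.sum_add_distrib, Finset.sum_sub_distrib, ← Finset.mul_sum, h₁, h₂, h₃, h₄, h₅, h₆,
    h, h', h'']
  ring

lemma transpose_Ric0 {R : Module.End ℝ (so n)} (hR : selfAdjEnd R) : (Ric0 R)ᵀ = Ric0 R := by
  have h : (RicM R)ᵀ = RicM R := by
    ext i j
    simp only [RicM, Matrix.transpose_apply, Matrix.of_apply, Rcoord]
    refine Finset.sum_congr rfl fun k _ => ?_
    rw [hR, ip_comm]
  simp [Ric0, h]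

lemma trace_Ric0 (hn : n ≠ 0) (R : Module.End ℝ (so n)) : (Ric0 R).trace = 0 := by
  have hn' : (n : ℝ) ≠ 0 := Nat.cast_ne_zero.2 hn
  simp [Ric0, lamb, Matrix.trace_sub, Matrix.trace_smul, hn']

lemma coe_wedge_one (A : Mat n) (M : so n) :
    (wedge A 1 M : Mat n) = (1 / 2 : ℝ) • (A * M + M * Aᵀ) := by
  change (1 / 2 : ℝ) • (A * (M : Mat n) * (1 : Mat n)ᵀ + 1 * (M : Mat n) * Aᵀ) = _
  simp

/-- Lemma: the Ricci tensor of `R² + R^#` for a curvature operator of Ricci type. -/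
theorem stmt_3 {n : ℕ} (hn : 3 ≤ n) (R : Module.End ℝ (so n)) (hR : isCurvOp R)
    (hRic : R = (lamb R / ((n : ℝ) - 1)) • wedge (1 : Mat n) (1 : Mat n)
        + (2 / ((n : ℝ) - 2)) • wedge (Ric0 R) (1 : Mat n)) :
    RicM (Qode R) =
      (-(2 / ((n : ℝ) - 2))) •
          (Ric0 R * Ric0 R - (Matrix.trace (Ric0 R * Ric0 R) / (n : ℝ)) • (1 : Mat n))
        + ((((n : ℝ) - 2) / ((n : ℝ) - 1)) * lamb R) • Ric0 R
        + lamb R ^ 2 • (1 : Mat n) + sigmaR R • (1 : Mat n) := by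
  have hn3 : (3 : ℝ) ≤ n := by exact_mod_cast hn
  have hn0 : (n : ℝ) ≠ 0 := by linarith
  have hn1 : (n : ℝ) - 1 ≠ 0 := by linarith
  have hn2 : (n : ℝ) - 2 ≠ 0 := by linarith
  have hT := transpose_Ric0 hR.1
  have htr := trace_Ric0 (by omega) R
  have hB : (((lamb R / ((n : ℝ) - 1)) / 2) • (1 : Mat n) + (1 / ((n : ℝ) - 2)) • Ric0 R)ᵀ
      = ((lamb R / ((n : ℝ) - 1)) / 2) • (1 : Mat n) + (1 / ((n : ℝ) - 2)) • Ric0 R := by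
    simp [hT]
  rw [RicM_Qode hR.1 hB]
  · simp only [sigmaR, Matrix.trace_add, Matrix.trace_smul, Matrix.trace_one, htr, Fintype.card_fin,
      add_mul, mul_add, smul_mul_assoc, mul_smul_comm, one_mul, mul_one, smul_eq_mul, mul_zero,
      add_zero, zero_add]
    match_scalars <;> field_simp <;> ring
  · intro M
    have hM := congrArg (fun S : Module.End ℝ (so n) => (S M : Mat n)) hRic
    simp only [LinearMap.add_apply, LinearMap.smul_apply, Submodule.coe_add, SetLike.val_smul,
      coe_wedge_one, hT, Matrix.transpose_one, one_mul, mul_one] at hM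
    rw [hM]
    simp only [add_mul, mul_add, smul_mul_assoc, mul_smul_comm, one_mul, mul_one]
    module

end BW
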